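/- Let n ≥ 1 and let R₁ := (ℤ/2)[x,v,w]/(x^{2n+2}, v² + 1 + (n+1)x^{2n}w). For c₂, c₃ ∈ ℤ/2 set w̃ := v·w + c₂·x^{2n}·w² + c₃·x^{2n}·v·w² in R₁. Then the ℤ/2-algebra homomorphism from (ℤ/2)[X,V,W]/(X^{2n+2}, V² + 1 + (n+1)X^{2n}VW) to R₁ determined by X ↦ x, V ↦ v, W ↦ w̃ is well defined and is an isomorphism of ℤ/2-algebras. -/

import Mathlib

open MvPolynomial

noncomputable section

/-- The polynomial ring `(ℤ/2)[x,v,w]`. -/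
abbrev P : Type := MvPolynomial (Fin 3) (ZMod 2)

/-- The ideal `(x^{2n+2}, v² + 1 + (n+1)·x^{2n}·w)` (the coefficient `n+1` read mod 2). -/
def relIdeal₁ (n : ℕ) : Ideal P :=
  Ideal.span {(X 0 : P) ^ (2 * n + 2),
    (X 1 : P) ^ 2 + 1 + C ((n : ZMod 2) + 1) * (X 0 : P) ^ (2 * n) * X 2}

/-- `R₁ = (ℤ/2)[x,v,w]/(x^{2n+2}, v² + 1 + (n+1)x^{2n}w)`. -/
abbrev R₁ (n : ℕ) : Type := P ⧸ relIdeal₁ n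

/-- The ideal `(X^{2n+2}, V² + 1 + (n+1)·X^{2n}·V·W)`. -/
def relIdealQ (n : ℕ) : Ideal P :=
  Ideal.span {(X 0 : P) ^ (2 * n + 2),
    (X 1 : P) ^ 2 + 1 + C ((n : ZMod 2) + 1) * (X 0 : P) ^ (2 * n) * X 1 * X 2}

/-- `Q = (ℤ/2)[X,V,W]/(X^{2n+2}, V² + 1 + (n+1)X^{2n}VW)`. -/
abbrev Q (n : ℕ) : Type := P ⧸ relIdealQ n

def mkR₁ (n : ℕ) : P →ₐ[ZMod 2] R₁ n := Ideal.Quotient.mkₐ (ZMod 2) (relIdeal₁ n)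
def mkQ (n : ℕ) : P →ₐ[ZMod 2] Q n := Ideal.Quotient.mkₐ (ZMod 2) (relIdealQ n)

def x (n : ℕ) : R₁ n := mkR₁ n (X 0)
def v (n : ℕ) : R₁ n := mkR₁ n (X 1)
def w (n : ℕ) : R₁ n := mkR₁ n (X 2)

def xQ (n : ℕ) : Q n := mkQ n (X 0)
def vQ (n : ℕ) : Q n := mkQ n (X 1)
def wQ (n : ℕ) : Q n := mkQ n (X 2)

section CharTwo

variable {A : Type*} [CommRing A] {a e c d s t : A}

/-- Substituting `t * s + c * (a * s ^ 2) + d * (a * t * s ^ 2)` for `s` turns the relation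
`t² + 1 + e a s = 0` into `t² + 1 + e a t s = 0`. -/
lemma twisted_relation (h2 : (2 : A) = 0) (ha : a * a = 0) (h : t ^ 2 + 1 + e * a * s = 0) :
    t ^ 2 + 1 + e * a * t * (t * s + c * (a * s ^ 2) + d * (a * t * s ^ 2)) = 0 := by
  have hat : a * t ^ 2 = a := by linear_combination a * h - e * s * ha - a * h2
  linear_combination h + e * s * hat + (e * t * c * s ^ 2 + e * t ^ 2 * d * s ^ 2) * ha

/-- The inverse of the substitution of `twisted_relation`. -/
lemma twisted_substitution_leftInverse (h2 : (2 : A) = 0) (ha : a * a = 0)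
    (h : t ^ 2 + 1 + e * a * s = 0) :
    t * (t * s + c * (a * s ^ 2) + d * (a * t * s ^ 2)) +
      a * (t * s + c * (a * s ^ 2) + d * (a * t * s ^ 2)) ^ 2 * (c * t + d + e) = s := by
  have hat : a * t ^ 2 = a := by linear_combination a * h - e * s * ha - a * h2
  have hsq : a * (t * s + c * (a * s ^ 2) + d * (a * t * s ^ 2)) ^ 2 = a * s ^ 2 := by
    grind
  rw [hsq]
  linear_combination s * h + d * s ^ 2 * hat + (c * t * a * s ^ 2 + d * a * s ^ 2 - s) * h2

/-- `twisted_relation` for the inverse substitution. -/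
lemma untwisted_relation (ha : a * a = 0) (h : t ^ 2 + 1 + e * a * t * s = 0) :
    t ^ 2 + 1 + e * a * (t * s + a * s ^ 2 * (c * t + d + e)) = 0 := by
  linear_combination h + e * s ^ 2 * (c * t + d + e) * ha

/-- The substitution of `twisted_relation` undoes its inverse. -/
lemma twisted_substitution_rightInverse (h2 : (2 : A) = 0) (ha : a * a = 0)
    (h : t ^ 2 + 1 + e * a * t * s = 0) :
    t * (t * s + a * s ^ 2 * (c * t + d + e)) +
      c * (a * (t * s + a * s ^ 2 * (c * t + d + e)) ^ 2) +
      d * (a * t * (t * s + a * s ^ 2 * (c * t + d + e)) ^ 2) = s := by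
  have hat : a * t ^ 2 = a := by linear_combination a * h - e * t * s * ha - a * h2
  have hsq : a * (t * s + a * s ^ 2 * (c * t + d + e)) ^ 2 = a * s ^ 2 := by
    grind
  linear_combination s * h + c * s ^ 2 * hat + (c + d * t) * hsq +
    (c * a * s ^ 2 + d * a * t * s ^ 2 - s) * h2

end CharTwo

lemma pow_two_mul_mul_self_eq_zero {A : Type*} [CommRing A] {n : ℕ} (hn : 1 ≤ n) {r : A}
    (hr : r ^ (2 * n + 2) = 0) : r ^ (2 * n) * r ^ (2 * n) = 0 := by
  rw [← pow_add]
  exact pow_eq_zero_of_le (by lia) hr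

lemma two_eq_zero_of_zmod_two_algebra (A : Type*) [CommRing A] [Algebra (ZMod 2) A] :
    (2 : A) = 0 := by
  have h : (2 : ZMod 2) = 0 := rfl
  rw [← map_ofNat (algebraMap (ZMod 2) A) 2, h, map_zero]

lemma x_pow (n : ℕ) : x n ^ (2 * n + 2) = 0 := by
  rw [x, ← map_pow]
  exact Ideal.Quotient.eq_zero_iff_mem.mpr (Ideal.subset_span (by simp))

lemma xQ_pow (n : ℕ) : xQ n ^ (2 * n + 2) = 0 := by
  rw [xQ, ← map_pow]
  exact Ideal.Quotient.eq_zero_iff_mem.mpr (Ideal.subset_span (by simp))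

lemma v_relation (n : ℕ) :
    v n ^ 2 + 1 + algebraMap (ZMod 2) (R₁ n) (n + 1) * x n ^ (2 * n) * w n = 0 := by
  have h : mkR₁ n (X 1 ^ 2 + 1 + C ((n : ZMod 2) + 1) * X 0 ^ (2 * n) * X 2) = 0 :=
    Ideal.Quotient.eq_zero_iff_mem.mpr (Ideal.subset_span (by simp))
  rwa [← algebraMap_eq, map_add, map_add, map_mul, map_mul, map_pow, map_pow, map_one,
    AlgHom.commutes] at h

lemma vQ_relation (n : ℕ) :
    vQ n ^ 2 + 1 + algebraMap (ZMod 2) (Q n) (n + 1) * xQ n ^ (2 * n) * vQ n * wQ n = 0 := by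
  have h : mkQ n (X 1 ^ 2 + 1 + C ((n : ZMod 2) + 1) * X 0 ^ (2 * n) * X 1 * X 2) = 0 :=
    Ideal.Quotient.eq_zero_iff_mem.mpr (Ideal.subset_span (by simp))
  rwa [← algebraMap_eq, map_add, map_add, map_mul, map_mul, map_mul, map_pow, map_pow, map_one,
    AlgHom.commutes] at h

/-- The universal property of `R₁ n`. -/
lemma exists_algHom_R₁ {A : Type*} [CommRing A] [Algebra (ZMod 2) A] (n : ℕ) {r t s : A}
    (hr : r ^ (2 * n + 2) = 0)
    (h : t ^ 2 + 1 + algebraMap (ZMod 2) A (n + 1) * r ^ (2 * n) * s = 0) :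
    ∃ f : R₁ n →ₐ[ZMod 2] A, f (x n) = r ∧ f (v n) = t ∧ f (w n) = s := by
  have hker : relIdeal₁ n ≤ RingHom.ker (aeval (R := ZMod 2) ![r, t, s]) := by
    rw [relIdeal₁, Ideal.span_le]
    rintro p (rfl | rfl)
    · simpa [RingHom.mem_ker] using hr
    · simpa [RingHom.mem_ker] using h
  refine ⟨Ideal.Quotient.liftₐ _ (aeval ![r, t, s]) fun p hp => hker hp, ?_, ?_, ?_⟩
  · exact aeval_X _ 0
  · exact aeval_X _ 1
  · exact aeval_X _ 2

/-- The universal property of `Q n`. -/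
lemma exists_algHom_Q {A : Type*} [CommRing A] [Algebra (ZMod 2) A] (n : ℕ) {r t s : A}
    (hr : r ^ (2 * n + 2) = 0)
    (h : t ^ 2 + 1 + algebraMap (ZMod 2) A (n + 1) * r ^ (2 * n) * t * s = 0) :
    ∃ f : Q n →ₐ[ZMod 2] A, f (xQ n) = r ∧ f (vQ n) = t ∧ f (wQ n) = s := by
  have hker : relIdealQ n ≤ RingHom.ker (aeval (R := ZMod 2) ![r, t, s]) := by
    rw [relIdealQ, Ideal.span_le]
    rintro p (rfl | rfl)
    · simpa [RingHom.mem_ker] using hr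
    · simpa [RingHom.mem_ker] using h
  refine ⟨Ideal.Quotient.liftₐ _ (aeval ![r, t, s]) fun p hp => hker hp, ?_, ?_, ?_⟩
  · exact aeval_X _ 0
  · exact aeval_X _ 1
  · exact aeval_X _ 2

lemma algHom_ext_R₁ {A : Type*} [CommRing A] [Algebra (ZMod 2) A] {n : ℕ}
    {f g : R₁ n →ₐ[ZMod 2] A} (hx : f (x n) = g (x n)) (hv : f (v n) = g (v n))
    (hw : f (w n) = g (w n)) : f = g := by
  apply Ideal.Quotient.algHom_ext
  apply MvPolynomial.algHom_ext
  intro i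
  fin_cases i
  exacts [hx, hv, hw]

lemma algHom_ext_Q {A : Type*} [CommRing A] [Algebra (ZMod 2) A] {n : ℕ}
    {f g : Q n →ₐ[ZMod 2] A} (hx : f (xQ n) = g (xQ n)) (hv : f (vQ n) = g (vQ n))
    (hw : f (wQ n) = g (wQ n)) : f = g := by
  apply Ideal.Quotient.algHom_ext
  apply MvPolynomial.algHom_ext
  intro i
  fin_cases i
  exacts [hx, hv, hw]

/-- For `w̃ = v·w + c₂ x^{2n} w² + c₃ x^{2n} v w²` in `R₁`, the `ℤ/2`-algebra
homomorphism from `(ℤ/2)[X,V,W]/(X^{2n+2}, V² + 1 + (n+1)X^{2n}VW)` to `R₁` determined by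
`X ↦ x`, `V ↦ v`, `W ↦ w̃` is well defined and an isomorphism. -/
theorem stmt_11 (n : ℕ) (hn : 1 ≤ n) (c₂ c₃ : ZMod 2) (wt : R₁ n)
    (hwt : wt = v n * w n + c₂ • (x n ^ (2 * n) * w n ^ 2)
      + c₃ • (x n ^ (2 * n) * v n * w n ^ 2)) :
    ∃ e : Q n ≃ₐ[ZMod 2] R₁ n,
      e (xQ n) = x n ∧ e (vQ n) = v n ∧ e (wQ n) = wt := by
  have hsmul (c : ZMod 2) (y : R₁ n) : c • y = algebraMap (ZMod 2) (R₁ n) c * y :=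
    Algebra.smul_def c y
  rw [hsmul, hsmul] at hwt
  have h2 := two_eq_zero_of_zmod_two_algebra (R₁ n)
  have h2Q := two_eq_zero_of_zmod_two_algebra (Q n)
  have ha := pow_two_mul_mul_self_eq_zero hn (x_pow n)
  have haQ := pow_two_mul_mul_self_eq_zero hn (xQ_pow n)
  have hrel := twisted_relation (c := algebraMap (ZMod 2) _ c₂) (d := algebraMap (ZMod 2) _ c₃)
    h2 ha (v_relation n)
  rw [← hwt] at hrel
  obtain ⟨f, hfx, hfv, hfw⟩ := exists_algHom_Q n (x_pow n) hrel
  obtain ⟨g, hgx, hgv, hgw⟩ := exists_algHom_R₁ n (xQ_pow n)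
    (untwisted_relation (c := algebraMap (ZMod 2) _ c₂) (d := algebraMap (ZMod 2) _ c₃)
      haQ (vQ_relation n))
  refine ⟨AlgEquiv.ofAlgHom f g (algHom_ext_R₁ ?_ ?_ ?_) (algHom_ext_Q ?_ ?_ ?_), hfx, hfv, hfw⟩
  · rw [AlgHom.comp_apply, hgx, hfx, AlgHom.id_apply]
  · rw [AlgHom.comp_apply, hgv, hfv, AlgHom.id_apply]
  · simp only [AlgHom.comp_apply, AlgHom.id_apply, hgw, map_add, map_mul, map_pow, hfx, hfv, hfw,
      AlgHom.commutes, hwt]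
    simpa only [map_add] using twisted_substitution_leftInverse h2 ha (v_relation n)
  · rw [AlgHom.comp_apply, hfx, hgx, AlgHom.id_apply]
  · rw [AlgHom.comp_apply, hfv, hgv, AlgHom.id_apply]
  · simp only [AlgHom.comp_apply, AlgHom.id_apply, hfw, hwt, map_add, map_mul, map_pow, hgx, hgv,
      hgw, AlgHom.commutes]
    simpa only [map_add] using twisted_substitution_rightInverse h2Q haQ (vQ_relation n)

end
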